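/- For every p ∈ ℝ and every r > 0, the first sine Fourier coefficient is given by the integral formula b₁(p,r) = −(2/r) ∫_{0}^{r} u · ∂(Mf)/∂p (p,u) du. -/

import Mathlib

open MeasureTheory Real Filter Finset

/-- Circular mean of `f` over the circle of radius `r` centered at `(p, 0)` on the x-axis:
`Mf(p,r) = (1/(2π)) ∫_{-π}^{π} f(p - r sin φ, r cos φ) dφ`. -/
noncomputable def circMean (f : ℝ × ℝ → ℝ) (p r : ℝ) : ℝ :=
  (1 / (2 * Real.pi)) * ∫ φ in (-Real.pi)..Real.pi, f (p - r * Real.sin φ, r * Real.cos φ)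

/-- `k`-th cosine Fourier coefficient of the restriction of `f` to the circle of
radius `r` centered at `(p, 0)`. -/
noncomputable def fourierA (f : ℝ × ℝ → ℝ) (k : ℕ) (p r : ℝ) : ℝ :=
  (1 / Real.pi) * ∫ φ in (-Real.pi)..Real.pi,
    f (p - r * Real.sin φ, r * Real.cos φ) * Real.cos (k * φ)

/-- `k`-th sine Fourier coefficient of the restriction of `f` to the circle of
radius `r` centered at `(p, 0)`. -/
noncomputable def fourierB (f : ℝ × ℝ → ℝ) (k : ℕ) (p r : ℝ) : ℝ :=
  (1 / Real.pi) * ∫ φ in (-Real.pi)..Real.pi,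
    f (p - r * Real.sin φ, r * Real.cos φ) * Real.sin (k * φ)

theorem hasDerivAt_intervalIntegral_of_continuous {F F' : ℝ → ℝ → ℝ} (a b x₀ : ℝ)
    (hF : Continuous (Function.uncurry F)) (hF' : Continuous (Function.uncurry F'))
    (h : ∀ x t, HasDerivAt (fun y => F y t) (F' x t) x) :
    HasDerivAt (fun x => ∫ t in a..b, F x t) (∫ t in a..b, F' x₀ t) x₀ := by
  have hK : IsCompact (Metric.closedBall x₀ 1 ×ˢ Set.uIcc a b) :=
    (isCompact_closedBall x₀ 1).prod isCompact_uIcc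
  obtain ⟨C, hC⟩ := hK.exists_bound_of_continuousOn hF'.continuousOn
  refine (intervalIntegral.hasDerivAt_integral_of_dominated_loc_of_deriv_le
    (bound := fun _ => C) (F := F) (F' := F')
    (Metric.closedBall_mem_nhds x₀ one_pos) ?_ ?_ ?_ ?_ ?_ ?_).2
  · exact Eventually.of_forall fun x => (hF.uncurry_left x).aestronglyMeasurable
  · exact (hF.uncurry_left x₀).intervalIntegrable a b
  · exact (hF'.uncurry_left x₀).aestronglyMeasurable
  · exact Eventually.of_forall fun t ht x hx =>
      hC (x, t) ⟨hx, Set.uIoc_subset_uIcc ht⟩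
  · exact intervalIntegrable_const
  · exact Eventually.of_forall fun t _ x _ => h x t

theorem hasDerivAt_comp_prodMk {f : ℝ × ℝ → ℝ} (hf : Differentiable ℝ f) {a b : ℝ → ℝ}
    {a' b' t : ℝ} (ha : HasDerivAt a a' t) (hb : HasDerivAt b b' t) :
    HasDerivAt (fun s => f (a s, b s))
      (a' * fderiv ℝ f (a t, b t) (1, 0) + b' * fderiv ℝ f (a t, b t) (0, 1)) t := by
  have h := (hf (a t, b t)).hasFDerivAt.comp_hasDerivAt t (ha.prodMk hb)
  have hv : ((a', b') : ℝ × ℝ) = a' • (1, 0) + b' • (0, 1) := by simp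
  rw [hv, map_add, map_smul, map_smul] at h
  exact h

theorem hasDerivAt_circMean {f : ℝ × ℝ → ℝ} (hf : ContDiff ℝ 1 f) (p u : ℝ) :
    HasDerivAt (fun p' => circMean f p' u)
      (circMean (fun q => fderiv ℝ f q (1, 0)) p u) p := by
  have hD := hf.continuous_fderiv one_ne_zero
  have hc := hf.continuous
  refine (hasDerivAt_intervalIntegral_of_continuous
    (F := fun x φ => f (x - u * Real.sin φ, u * Real.cos φ))
    (F' := fun x φ => fderiv ℝ f (x - u * Real.sin φ, u * Real.cos φ) (1, 0))
    (-Real.pi) Real.pi p (by fun_prop) (by fun_prop) fun x φ => ?_).const_mul _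
  simpa using hasDerivAt_comp_prodMk (hf.differentiable one_ne_zero)
    ((hasDerivAt_id x).sub_const (u * Real.sin φ)) (hasDerivAt_const x (u * Real.cos φ))

/-- The radial derivative of the flux of `(f, 0)` through the circle of radius `r`. -/
theorem hasDerivAt_mul_integral_sin {f : ℝ × ℝ → ℝ} (hf : ContDiff ℝ 1 f) (p r : ℝ) :
    HasDerivAt
      (fun s => ∫ φ in (-Real.pi)..Real.pi,
        s * (f (p - s * Real.sin φ, s * Real.cos φ) * Real.sin φ))
      (∫ φ in (-Real.pi)..Real.pi,
        -(r * fderiv ℝ f (p - r * Real.sin φ, r * Real.cos φ) (1, 0))) r := by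
  have hD := hf.continuous_fderiv one_ne_zero
  have hc := hf.continuous
  have hd := hf.differentiable one_ne_zero
  let G : ℝ → ℝ → ℝ := fun s φ =>
    f (p - s * Real.sin φ, s * Real.cos φ) * Real.sin φ
      + s * ((-Real.sin φ * fderiv ℝ f (p - s * Real.sin φ, s * Real.cos φ) (1, 0)
        + Real.cos φ * fderiv ℝ f (p - s * Real.sin φ, s * Real.cos φ) (0, 1)) * Real.sin φ)
  let T : ℝ → ℝ := fun φ =>
    (-(r * Real.cos φ) * fderiv ℝ f (p - r * Real.sin φ, r * Real.cos φ) (1, 0)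
      + -(r * Real.sin φ) * fderiv ℝ f (p - r * Real.sin φ, r * Real.cos φ) (0, 1)) * Real.cos φ
      + f (p - r * Real.sin φ, r * Real.cos φ) * -Real.sin φ
  have hG : Continuous (Function.uncurry G) := by
    simp only [G, Function.uncurry_def]; fun_prop
  have hT : Continuous T := by simp only [T]; fun_prop
  have hT0 : ∫ φ in (-Real.pi)..Real.pi, T φ = 0 := by
    rw [intervalIntegral.integral_eq_sub_of_hasDerivAt
      (f := fun φ => f (p - r * Real.sin φ, r * Real.cos φ) * Real.cos φ)
      (fun φ _ => ?_) (hT.intervalIntegrable _ _)]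
    · simp
    · refine (hasDerivAt_comp_prodMk hd (((Real.hasDerivAt_sin φ).const_mul r).const_sub p) ?_).mul
        (Real.hasDerivAt_cos φ)
      simpa using (Real.hasDerivAt_cos φ).const_mul r
  have key : ∫ φ in (-Real.pi)..Real.pi,
      -(r * fderiv ℝ f (p - r * Real.sin φ, r * Real.cos φ) (1, 0))
        = ∫ φ in (-Real.pi)..Real.pi, G r φ := by
    have hadd := intervalIntegral.integral_add
      ((hG.uncurry_left r).intervalIntegrable (μ := volume) (-Real.pi) Real.pi)
      (hT.intervalIntegrable (-Real.pi) Real.pi)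
    rw [hT0, add_zero] at hadd
    rw [← hadd]
    refine intervalIntegral.integral_congr fun φ _ => ?_
    simp only [G, T]
    linear_combination r * fderiv ℝ f (p - r * Real.sin φ, r * Real.cos φ) (1, 0) *
      Real.sin_sq_add_cos_sq φ
  rw [key]
  refine hasDerivAt_intervalIntegral_of_continuous
    (F := fun s φ => s * (f (p - s * Real.sin φ, s * Real.cos φ) * Real.sin φ)) (F' := G)
    (-Real.pi) Real.pi r (by fun_prop) hG fun s φ => ?_
  have h1 : HasDerivAt (fun s => p - s * Real.sin φ) (-Real.sin φ) s := by
    simpa using ((hasDerivAt_id s).mul_const (Real.sin φ)).const_sub p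
  have h2 : HasDerivAt (fun s => s * Real.cos φ) (Real.cos φ) s := by
    simpa using (hasDerivAt_id s).mul_const (Real.cos φ)
  have h3 := (hasDerivAt_id s).mul ((hasDerivAt_comp_prodMk hd h1 h2).mul_const (Real.sin φ))
  rw [one_mul] at h3
  exact h3

/-- Explicit integral formula for the first sine coefficient:
`b₁(p,r) = -(2/r) ∫_0^r u ∂(Mf)/∂p (p,u) du`. -/
theorem b_one_formula (f : ℝ × ℝ → ℝ) (hf : ContDiff ℝ (⊤ : ℕ∞) f)
    (hfc : HasCompactSupport f) (hfs : tsupport f ⊆ {q : ℝ × ℝ | 0 < q.2})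
    (p r : ℝ) (hr : 0 < r) :
    fourierB f 1 p r
      = -(2 / r) * ∫ u in (0:ℝ)..r, u * deriv (fun p' => circMean f p' u) p := by
  have hf1 : ContDiff ℝ 1 f := hf.of_le (by exact_mod_cast le_top)
  have hD := hf1.continuous_fderiv one_ne_zero
  have hcont : Continuous fun u : ℝ => ∫ φ in (-Real.pi)..Real.pi,
      -(u * fderiv ℝ f (p - u * Real.sin φ, u * Real.cos φ) (1, 0)) :=
    intervalIntegral.continuous_parametric_intervalIntegral_of_continuous'
      (f := fun u φ => -(u * fderiv ℝ f (p - u * Real.sin φ, u * Real.cos φ) (1, 0)))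
      (by fun_prop) _ _
  have hftc := intervalIntegral.integral_eq_sub_of_hasDerivAt
    (fun u _ => hasDerivAt_mul_integral_sin hf1 p u) (hcont.intervalIntegrable 0 r)
  have hmean : ∀ u : ℝ, u * deriv (fun p' => circMean f p' u) p
      = -(1 / (2 * Real.pi)) * ∫ φ in (-Real.pi)..Real.pi,
        -(u * fderiv ℝ f (p - u * Real.sin φ, u * Real.cos φ) (1, 0)) := fun u => by
    rw [(hasDerivAt_circMean hf1 p u).deriv, circMean, intervalIntegral.integral_neg,
      intervalIntegral.integral_const_mul]
    ring
  simp only [hmean]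
  rw [intervalIntegral.integral_const_mul, hftc, intervalIntegral.integral_const_mul,
    fourierB]
  simp only [Nat.cast_one, one_mul, zero_mul, intervalIntegral.integral_zero, sub_zero]
  field_simp
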